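/- arXiv:2206.02028 — 2 statements merged into one kernel-verified Lean document; each statement's English description precedes it below -/
import Mathlib

section
/- Let m ≥ 3 be an odd integer, n ≥ 6 an even integer such that n₁ = n/2 is even, and n₀ = n₁ − 1. Let (a_1,…,a_{n₀}) be one of the following palindromic sequences: (1) a_{2k−1} = mn for 1 ≤ k ≤ n₁/2 and a_{2k} = mn + 2 for 1 ≤ k ≤ n₁/2 − 1; (2) a_{2k−1} = mn − 1 for 1 ≤ k ≤ n₁/2 and a_{2k} = mn + 3 for 1 ≤ k ≤ n₁/2 − 1; (3) a_{2k−1} = m(n−1) + 1 for 1 ≤ k ≤ n₁/2 and a_{2k} = m(n+1) + 1 for 1 ≤ k ≤ n₁/2 − 1; (4) a_{2k−1} = m(n−2) + 1 for 1 ≤ k ≤ n₁/2 and a_{2k} = m(n+2) + 1 for 1 ≤ k ≤ n₁/2 − 1. Then there exist at least 2^{m−1}·(m−1)! pairwise Klein bottle nonequivalent C₄-face-magic Klein bottle labelings x on 𝒦_{m,n} satisfying x_{1,k} + x_{1,k+1} = a_k for all 1 ≤ k ≤ n₀. -/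
/-- Reduction of a (positive) index modulo `n` to a representative in `{1, …, n}`. -/
def wrap (n j : ℕ) : ℕ := if j % n = 0 then n else j % n

/-- `x` is a C₄-face-magic Klein bottle labeling of the `m × n` Klein bottle grid graph
`𝒦_{m,n}` with C₄-face-magic value `S`: `x` is a bijection from `{1,…,m} × {1,…,n}`
onto `{1,…,m*n}` and every C₄-face of the natural embedding of `𝒦_{m,n}` in the Klein
bottle has vertex-label sum `S`. -/
def IsC4FaceMagic (m n : ℕ) (x : ℕ × ℕ → ℕ) (S : ℕ) : Prop :=
  Set.BijOn x (Set.Icc 1 m ×ˢ Set.Icc 1 n) (Set.Icc 1 (m * n)) ∧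
  (∀ i j, 1 ≤ i → i + 1 ≤ m → 1 ≤ j → j ≤ n →
    x (i, j) + x (i + 1, j) + x (i, wrap n (j + 1)) + x (i + 1, wrap n (j + 1)) = S) ∧
  (∀ j, 1 ≤ j → j ≤ n →
    x (m, j) + x (m, wrap n (j + 1)) + x (1, n + 1 - j) + x (1, wrap n (n - j)) = S)

/-- The symmetry `U` of the Klein bottle: `U(i,j) = (i+1,j)` for `1 ≤ i ≤ m-1` and
`U(m,j) = (1, n+1-j)`. -/
def Umap (m n : ℕ) : ℕ × ℕ → ℕ × ℕ := fun p => if p.1 < m then (p.1 + 1, p.2) else (1, n + 1 - p.2)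

/-- The symmetry `H` of the Klein bottle: `H(i,j) = (i, j + n/2)`, second coordinate
taken modulo `n` with representative in `{1,…,n}`. -/
def Hmap (n : ℕ) : ℕ × ℕ → ℕ × ℕ := fun p => (p.1, wrap n (p.2 + n / 2))

/-- The reflection `F` of the Klein bottle: `F(i,j) = (i, n+1-j)`. -/
def Fmap (n : ℕ) : ℕ × ℕ → ℕ × ℕ := fun p => (p.1, n + 1 - p.2)

/-- Membership in the Klein bottle labeling symmetry group `KBLS(m,n)`, the group of
permutations of `{1,…,m} × {1,…,n}` generated by `U`, `H` and `F`. -/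
inductive MemKBLS (m n : ℕ) : (ℕ × ℕ → ℕ × ℕ) → Prop
  | one : MemKBLS m n id
  | genU : MemKBLS m n (Umap m n)
  | genH : MemKBLS m n (Hmap n)
  | genF : MemKBLS m n (Fmap n)
  | comp {f g : ℕ × ℕ → ℕ × ℕ} : MemKBLS m n f → MemKBLS m n g → MemKBLS m n (f ∘ g)

/-- Two labelings of `𝒦_{m,n}` are Klein bottle equivalent if one is obtained from the
other by composing with a member of `KBLS(m,n)`. -/
def KBEquiv (m n : ℕ) (x y : ℕ × ℕ → ℕ) : Prop :=
  ∃ A, MemKBLS m n A ∧ ∀ p ∈ Set.Icc 1 m ×ˢ Set.Icc 1 n, y p = x (A p)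

/-- The column coordinate folded at the middle: `0, 1, …, n/2 - 1, n/2 - 1, …, 1, 0`. -/
def foldCol (n j : ℕ) : ℕ := if j ≤ n / 2 then j - 1 else n - j

/-- The position inside the arithmetic progression assigned to row `i` that is used in column `j`.
The progression is run through backwards in even rows if `e` holds and in odd rows otherwise. -/
def rowPos (n : ℕ) (e : Bool) (i j : ℕ) : ℕ :=
  if e = decide (i % 2 = 0) then n / 2 - 1 - foldCol n j else foldCol n j

/-- The labeling whose row `i` consists of the arithmetic progression of length `n / 2` and
difference `d` starting at `c (b i)` together with its complement with respect to `m * n + 1`.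
The complement occupies the even columns if `e i` holds and the odd columns otherwise. -/
def progLabel (m n d : ℕ) (c b : ℕ → ℕ) (e : ℕ → Bool) (p : ℕ × ℕ) : ℕ :=
  if e p.1 = decide (p.2 % 2 = 0) then m * n + 1 - (c (b p.1) + d * rowPos n (e p.1) p.1 p.2)
  else c (b p.1) + d * rowPos n (e p.1) p.1 p.2

/-- The progressions `c k, c k + d, …, c k + d * (n / 2 - 1)` for `k < m`, together with their
complements with respect to `m * n + 1`, are pairwise disjoint and contained in `{1, …, m * n}`. -/
structure IsProgPartition (m n d : ℕ) (c : ℕ → ℕ) : Prop where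
  pos : ∀ k t, k < m → t < n / 2 → 1 ≤ c k + d * t
  le : ∀ k t, k < m → t < n / 2 → c k + d * t ≤ m * n
  inj : ∀ k t k' t', k < m → t < n / 2 → k' < m → t' < n / 2 →
    c k + d * t = c k' + d * t' → k = k' ∧ t = t'
  disj : ∀ k t k' t', k < m → t < n / 2 → k' < m → t' < n / 2 →
    c k + d * t + (c k' + d * t') ≠ m * n + 1

theorem foldCol_lt {n j : ℕ} (h1 : 1 ≤ j) (h2 : j ≤ n) (hn : n % 2 = 0) :
    foldCol n j < n / 2 := by
  unfold foldCol; split_ifs <;> omega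

theorem rowPos_lt {n j : ℕ} (e : Bool) (i : ℕ) (h1 : 1 ≤ j) (h2 : j ≤ n) (hn : n % 2 = 0) :
    rowPos n e i j < n / 2 := by
  have := foldCol_lt h1 h2 hn
  unfold rowPos; split_ifs <;> omega

theorem wrap_of_lt {n j : ℕ} (h1 : 1 ≤ j) (h2 : j < n) : wrap n j = j := by
  unfold wrap; rw [Nat.mod_eq_of_lt h2, if_neg (by omega)]

theorem wrap_self (n : ℕ) : wrap n n = n := by
  simp [wrap]

theorem wrap_zero (n : ℕ) : wrap n 0 = n := by
  simp [wrap]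

theorem wrap_add_self {n j : ℕ} (h1 : 1 ≤ j) (h2 : j < n) : wrap n (j + n) = j := by
  unfold wrap; rw [Nat.add_mod_right, Nat.mod_eq_of_lt h2, if_neg (by omega)]

theorem progLabel_add_adjacent {m n d : ℕ} {c b : ℕ → ℕ} (e : ℕ → Bool)
    (h : IsProgPartition m n d c) (hn : n % 2 = 0) {i j j' : ℕ} (hb : b i < m)
    (h1 : 1 ≤ j) (h2 : j ≤ n) (h1' : 1 ≤ j') (h2' : j' ≤ n) (hj : j % 2 ≠ j' % 2) :
    (progLabel m n d c b e (i, j) : ℤ) + progLabel m n d c b e (i, j') =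
      m * n + 1 + (-1) ^ (i + j) * d * (foldCol n j - foldCol n j') := by
  have hf := foldCol_lt h1 h2 hn
  have hf' := foldCol_lt h1' h2' hn
  have hle := h.le _ _ hb (rowPos_lt (e i) i h1 h2 hn)
  have hle' := h.le _ _ hb (rowPos_lt (e i) i h1' h2' hn)
  have hr : ((n / 2 - 1 - foldCol n j : ℕ) : ℤ) = ((n / 2 : ℕ) : ℤ) - 1 - foldCol n j := by omega
  have hr' : ((n / 2 - 1 - foldCol n j' : ℕ) : ℤ) = ((n / 2 : ℕ) : ℤ) - 1 - foldCol n j' := by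
    omega
  have sub_cast : ∀ v : ℕ, v ≤ m * n → ((m * n + 1 - v : ℕ) : ℤ) = m * n + 1 - v := by
    intro v hv
    rw [Nat.cast_sub (by omega)]; push_cast; ring
  have hs : ((-1 : ℤ)) ^ (i + j) = if (i % 2 + j % 2) % 2 = 0 then 1 else -1 := by
    rw [neg_one_pow_eq_ite, ← Nat.add_mod]
    simp only [Nat.even_iff]
  rw [hs]
  unfold progLabel rowPos at *
  dsimp only
  rcases Nat.mod_two_eq_zero_or_one i with hi | hi <;>
  rcases Nat.mod_two_eq_zero_or_one j with hj1 | hj1 <;>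
  rcases Nat.mod_two_eq_zero_or_one j' with hj2 | hj2 <;>
  first
  | omega
  | cases hei : e i <;>
    simp [hei, hi, hj1, hj2] at hle hle' ⊢ <;>
    (first | rw [sub_cast _ hle] | rw [sub_cast _ hle']) <;>
    push_cast [hr, hr'] <;>
    ring

theorem progLabel_bijOn {m n d : ℕ} {c b : ℕ → ℕ} (e : ℕ → Bool)
    (h : IsProgPartition m n d c) (hn : n % 2 = 0)
    (hb : ∀ i, 1 ≤ i → i ≤ m → b i < m)
    (hbi : ∀ i i', 1 ≤ i → i ≤ m → 1 ≤ i' → i' ≤ m → b i = b i' → i = i') :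
    Set.BijOn (progLabel m n d c b e) (Set.Icc 1 m ×ˢ Set.Icc 1 n) (Set.Icc 1 (m * n)) := by
  have hmaps : ∀ p ∈ Finset.Icc 1 m ×ˢ Finset.Icc 1 n,
      progLabel m n d c b e p ∈ Finset.Icc 1 (m * n) := by
    rintro ⟨i, j⟩ hp
    simp only [Finset.mem_product, Finset.mem_Icc] at hp
    have ht := rowPos_lt (e i) i hp.2.1 hp.2.2 hn
    have h1 := h.pos _ _ (hb i hp.1.1 hp.1.2) ht
    have h2 := h.le _ _ (hb i hp.1.1 hp.1.2) ht
    rw [Finset.mem_Icc]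
    unfold progLabel
    split_ifs <;> constructor <;> dsimp only at * <;> omega
  have hinj : Set.InjOn (progLabel m n d c b e)
      ((Finset.Icc 1 m ×ˢ Finset.Icc 1 n : Finset (ℕ × ℕ)) : Set (ℕ × ℕ)) := by
    rintro ⟨i, j⟩ hp ⟨i', j'⟩ hp' heq
    simp only [Finset.coe_product, Finset.coe_Icc, Set.mem_prod, Set.mem_Icc] at hp hp'
    have hbp := hb i hp.1.1 hp.1.2
    have hbp' := hb i' hp'.1.1 hp'.1.2
    have ht := rowPos_lt (e i) i hp.2.1 hp.2.2 hn
    have ht' := rowPos_lt (e i') i' hp'.2.1 hp'.2.2 hn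
    have hle := h.le _ _ hbp ht
    have hle' := h.le _ _ hbp' ht'
    have hd := h.disj _ _ _ _ hbp ht hbp' ht'
    have key : (e i = decide (j % 2 = 0) ↔ e i' = decide (j' % 2 = 0)) ∧
        c (b i) + d * rowPos n (e i) i j = c (b i') + d * rowPos n (e i') i' j' := by
      unfold progLabel at heq
      dsimp only at heq
      split_ifs at heq with h1 h2 h2
      · exact ⟨iff_of_true h1 h2, by omega⟩
      · omega
      · omega
      · exact ⟨iff_of_false h1 h2, heq⟩
    obtain ⟨hiff, hv⟩ := key
    obtain ⟨hbe, hte⟩ := h.inj _ _ _ _ hbp ht hbp' ht' hv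
    obtain rfl := hbi i i' hp.1.1 hp.1.2 hp'.1.1 hp'.1.2 hbe
    have hpar : j % 2 = j' % 2 := by
      rcases Nat.mod_two_eq_zero_or_one j with hj1 | hj1 <;>
      rcases Nat.mod_two_eq_zero_or_one j' with hj2 | hj2 <;>
      cases hei : e i <;> simp [hj1, hj2, hei] at hiff ⊢
    have hf := foldCol_lt hp.2.1 hp.2.2 hn
    have hf' := foldCol_lt hp'.2.1 hp'.2.2 hn
    have hfe : foldCol n j = foldCol n j' := by
      unfold rowPos at hte
      split_ifs at hte <;> omega
    have : j = j' := by
      unfold foldCol at hfe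
      split_ifs at hfe <;> omega
    rw [this]
  have hsurj := Finset.surjOn_of_injOn_of_card_le _ hmaps hinj (by simp)
  have hco : ((Finset.Icc 1 m ×ˢ Finset.Icc 1 n : Finset (ℕ × ℕ)) : Set (ℕ × ℕ)) =
      Set.Icc 1 m ×ˢ Set.Icc 1 n := by simp
  rw [← hco]
  refine ⟨fun p hp => ?_, hinj, ?_⟩
  · simpa using hmaps p hp
  · simpa using hsurj

theorem isC4FaceMagic_progLabel {m n d : ℕ} {c b : ℕ → ℕ} (e : ℕ → Bool)
    (h : IsProgPartition m n d c) (hmo : m % 2 = 1) (hn : n % 2 = 0)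
    (hb : ∀ i, 1 ≤ i → i ≤ m → b i < m)
    (hbi : ∀ i i', 1 ≤ i → i ≤ m → 1 ≤ i' → i' ≤ m → b i = b i' → i = i') :
    IsC4FaceMagic m n (progLabel m n d c b e) (2 * (m * n + 1)) := by
  have hm : 1 ≤ m := by omega
  have hw : ∀ j, 1 ≤ j → j ≤ n → 1 ≤ wrap n (j + 1) ∧ wrap n (j + 1) ≤ n ∧
      j % 2 ≠ wrap n (j + 1) % 2 := by
    intro j h1 h2
    rcases Nat.lt_trichotomy (j + 1) n with hj | hj | hj
    · rw [wrap_of_lt (by omega) hj]; omega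
    · rw [hj, wrap_self]; omega
    · obtain rfl : j = n := by omega
      rw [add_comm, wrap_add_self le_rfl (by omega)]; omega
  refine ⟨progLabel_bijOn e h hn hb hbi, ?_, ?_⟩
  · intro i j hi hi' h1 h2
    obtain ⟨w1, w2, w3⟩ := hw j h1 h2
    have e1 := progLabel_add_adjacent e h hn (hb i hi (by omega)) h1 h2 w1 w2 w3
    have e2 := progLabel_add_adjacent e h hn (hb (i + 1) (by omega) hi') h1 h2 w1 w2 w3
    have e3 : (-1 : ℤ) ^ (i + 1 + j) = -(-1) ^ (i + j) := by
      rw [add_right_comm, pow_succ]; ring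
    rw [e3] at e2
    zify
    linear_combination e1 + e2
  · intro j h1 h2
    obtain ⟨w1, w2, w3⟩ := hw j h1 h2
    have hl : 1 ≤ wrap n (n - j) ∧ wrap n (n - j) ≤ n ∧
        (n + 1 - j) % 2 ≠ wrap n (n - j) % 2 ∧
        foldCol n (wrap n (n - j)) = foldCol n (wrap n (j + 1)) := by
      rcases Nat.lt_trichotomy (j + 1) n with hj | hj | hj
      · rw [wrap_of_lt (by omega) (by omega), wrap_of_lt (by omega) hj]
        unfold foldCol
        split_ifs <;> omega
      · rw [hj, wrap_self, show n - j = 1 by omega, wrap_of_lt le_rfl (by omega)]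
        unfold foldCol
        split_ifs <;> omega
      · obtain rfl : j = n := by omega
        rw [Nat.sub_self, wrap_zero, add_comm j 1, wrap_add_self le_rfl (by omega)]
        unfold foldCol
        split_ifs <;> omega
    obtain ⟨l1, l2, l3, l4⟩ := hl
    have e1 := progLabel_add_adjacent e h hn (hb m hm le_rfl) h1 h2 w1 w2 w3
    have e2 := progLabel_add_adjacent e h hn (hb 1 le_rfl hm) (by omega : 1 ≤ n + 1 - j) (by omega)
      l1 l2 l3
    have e3 : (-1 : ℤ) ^ (1 + (n + 1 - j)) = -(-1) ^ (m + j) := by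
      rw [neg_one_pow_eq_ite, neg_one_pow_eq_ite]
      simp only [Nat.even_iff]
      split_ifs <;> omega
    have e4 : foldCol n (n + 1 - j) = foldCol n j := by
      unfold foldCol
      split_ifs <;> omega
    rw [e3, e4, l4] at e2
    zify
    linear_combination e1 + e2

/-- The normal form of the elements of `KBLS(m,n)`: shift the rows by `k`, reflecting the columns
at each passage through the last row, and shift the columns by `n / 2` when `s` holds. -/
def kbNormal (m n k : ℕ) (s : Bool) (p : ℕ × ℕ) : ℕ × ℕ :=
  ((p.1 - 1 + k) % m + 1,
    if (p.1 - 1 + k) / m % 2 = 1 then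
      n + 1 - (if s then (if p.2 ≤ n / 2 then p.2 + n / 2 else p.2 - n / 2) else p.2)
    else (if s then (if p.2 ≤ n / 2 then p.2 + n / 2 else p.2 - n / 2) else p.2))

theorem kbNormal_mem {m n k : ℕ} {s : Bool} (hm : 1 ≤ m) (hn : n % 2 = 0) {i j : ℕ}
    (h1 : 1 ≤ j) (h2 : j ≤ n) :
    1 ≤ (kbNormal m n k s (i, j)).1 ∧ (kbNormal m n k s (i, j)).1 ≤ m ∧
      1 ≤ (kbNormal m n k s (i, j)).2 ∧ (kbNormal m n k s (i, j)).2 ≤ n := by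
  have := Nat.mod_lt (i - 1 + k) (show 0 < m by omega)
  unfold kbNormal
  dsimp only
  refine ⟨by omega, by omega, ?_, ?_⟩ <;> split_ifs <;> omega

theorem kbNormal_comp {m n k k' : ℕ} {s s' : Bool} (hm : 1 ≤ m) (hn : n % 2 = 0) {i j : ℕ}
    (h1 : 1 ≤ j) (h2 : j ≤ n) :
    kbNormal m n k s (kbNormal m n k' s' (i, j)) = kbNormal m n (k' + k) (xor s s') (i, j) := by
  have hq : (i - 1 + (k' + k)) / m = (i - 1 + k') / m + ((i - 1 + k') % m + k) / m := by
    conv_lhs => rw [← add_assoc, ← Nat.div_add_mod (i - 1 + k') m, add_assoc]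
    rw [Nat.mul_add_div (by omega)]
  unfold kbNormal
  dsimp only
  rw [Nat.add_sub_cancel, Nat.mod_add_mod, hq, ← add_assoc]
  congr 1
  generalize (i - 1 + k') / m = u
  generalize ((i - 1 + k') % m + k) / m = w
  cases s <;> cases s' <;> simp <;> split_ifs <;> omega

theorem MemKBLS.exists_kbNormal {m n : ℕ} (hm : 2 ≤ m) (hn : n % 2 = 0) {A : ℕ × ℕ → ℕ × ℕ}
    (hA : MemKBLS m n A) :
    ∃ k s, ∀ i j, 1 ≤ i → i ≤ m → 1 ≤ j → j ≤ n → A (i, j) = kbNormal m n k s (i, j) := by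
  induction hA with
  | one =>
    refine ⟨0, false, fun i j hi hi' h1 h2 => ?_⟩
    have e1 : (i - 1) / m = 0 := Nat.div_eq_of_lt (by omega)
    have e2 : (i - 1) % m = i - 1 := Nat.mod_eq_of_lt (by omega)
    simp [kbNormal, e1, e2, Nat.sub_add_cancel hi]
  | genU =>
    refine ⟨1, false, fun i j hi hi' h1 h2 => ?_⟩
    rcases hi'.lt_or_eq with hlt | rfl
    · have e1 : i / m = 0 := Nat.div_eq_of_lt (by omega)
      have e2 : i % m = i := Nat.mod_eq_of_lt (by omega)
      simp [kbNormal, Umap, Nat.sub_add_cancel hi, e1, e2, hlt]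
    · simp [kbNormal, Umap, Nat.sub_add_cancel hi, Nat.div_self hi]
  | genH =>
    refine ⟨0, true, fun i j hi hi' h1 h2 => ?_⟩
    have e1 : (i - 1) / m = 0 := Nat.div_eq_of_lt (by omega)
    have e2 : (i - 1) % m = i - 1 := Nat.mod_eq_of_lt (by omega)
    have e3 : wrap n (j + n / 2) = if j ≤ n / 2 then j + n / 2 else j - n / 2 := by
      split_ifs with hj
      · rcases Nat.lt_or_ge (j + n / 2) n with hlt | hge
        · exact wrap_of_lt (by omega) hlt
        · rw [show j + n / 2 = n by omega, wrap_self]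
      · rw [show j + n / 2 = (j - n / 2) + n by omega, wrap_add_self (by omega) (by omega)]
    simp only [kbNormal, Hmap, e1, e2, e3, add_zero, Nat.sub_add_cancel hi]
    simp
  | genF =>
    refine ⟨m, false, fun i j hi hi' h1 h2 => ?_⟩
    have e1 : (i - 1 + m) / m = 1 := by
      rw [Nat.add_div_right _ (by omega), Nat.div_eq_of_lt (by omega)]
    have e2 : (i - 1 + m) % m = i - 1 := by
      rw [Nat.add_mod_right, Nat.mod_eq_of_lt (by omega)]
    simp [kbNormal, Fmap, e1, e2, Nat.sub_add_cancel hi]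
  | comp _ _ ihf ihg =>
    obtain ⟨k, s, hf⟩ := ihf
    obtain ⟨k', s', hg⟩ := ihg
    refine ⟨k' + k, xor s s', fun i j hi hi' h1 h2 => ?_⟩
    obtain ⟨q1, q2, q3, q4⟩ := kbNormal_mem (m := m) (k := k') (s := s') (i := i)
      (by omega) hn h1 h2
    rw [Function.comp_apply, hg i j hi hi' h1 h2, ← kbNormal_comp (by omega) hn h1 h2]
    exact hf _ _ q1 q2 q3 q4

/-- An element of `KBLS(m,n)` that fixes the vertex `(1,1)` fixes every vertex. -/
theorem kbNormal_eq_self {m n k : ℕ} {s : Bool} (hn : n % 2 = 0)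
    (hn3 : 3 ≤ n) (h : kbNormal m n k s (1, 1) = (1, 1)) {i j : ℕ} (hi : 1 ≤ i) (hi' : i ≤ m) :
    kbNormal m n k s (i, j) = (i, j) := by
  have hm : 0 < m := by omega
  unfold kbNormal at h
  simp only [Nat.sub_self, zero_add, Prod.mk.injEq] at h
  obtain ⟨hk, hc⟩ := h
  have hk0 : k % m = 0 := by omega
  have hs : s = false ∧ k / m % 2 = 0 := by
    cases s
    · refine ⟨rfl, ?_⟩
      by_contra hne
      rw [if_pos (by omega)] at hc
      simp at hc
      omega
    · simp at hc
      split_ifs at hc <;> omega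
  obtain ⟨rfl, hpar⟩ := hs
  obtain ⟨l, rfl⟩ := Nat.dvd_of_mod_eq_zero hk0
  rw [Nat.mul_div_cancel_left _ hm] at hpar
  have e1 : (i - 1 + m * l) / m = l := by
    rw [Nat.add_mul_div_left _ _ hm, Nat.div_eq_of_lt (by omega), zero_add]
  have e2 : (i - 1 + m * l) % m = i - 1 := by
    rw [Nat.add_mul_mod_self_left, Nat.mod_eq_of_lt (by omega)]
  simp [kbNormal, e1, e2, hpar, Nat.sub_add_cancel hi]

/-- The block of row `i`: row `1` has block `0`, the other rows are permuted by `σ`. -/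
def rowBlock {m : ℕ} (σ : Equiv.Perm (Fin (m - 1))) (i : ℕ) : ℕ :=
  if h : 2 ≤ i ∧ i ≤ m then σ ⟨i - 2, by omega⟩ + 1 else 0

/-- The sign of row `i`: row `1` is positive, the signs of the other rows are given by `f`. -/
def rowSign {m : ℕ} (f : Fin (m - 1) → Bool) (i : ℕ) : Bool :=
  if h : 2 ≤ i ∧ i ≤ m then f ⟨i - 2, by omega⟩ else true

theorem rowBlock_lt {m : ℕ} (σ : Equiv.Perm (Fin (m - 1))) {i : ℕ} (hm : 1 ≤ m) :
    rowBlock σ i < m := by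
  unfold rowBlock
  split_ifs with h
  · have := (σ ⟨i - 2, by omega⟩).isLt
    omega
  · omega

theorem rowBlock_inj {m : ℕ} (σ : Equiv.Perm (Fin (m - 1))) (i i' : ℕ) (hi : 1 ≤ i)
    (him : i ≤ m) (hi' : 1 ≤ i') (him' : i' ≤ m) (h : rowBlock σ i = rowBlock σ i') : i = i' := by
  unfold rowBlock at h
  split_ifs at h with h1 h2 h2
  · have := σ.injective (Fin.ext (Nat.succ_injective h))
    rw [Fin.mk.injEq] at this
    omega
  · omega

/-- The labelings whose first row has block `0` and positive sign. -/
def normLabel (m n d : ℕ) (c : ℕ → ℕ) (q : Equiv.Perm (Fin (m - 1)) × (Fin (m - 1) → Bool)) :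
    ℕ × ℕ → ℕ :=
  progLabel m n d c (rowBlock q.1) (rowSign q.2)

theorem normLabel_ext {m n d : ℕ} {c : ℕ → ℕ} (h : IsProgPartition m n d c) (hm : 1 ≤ m)
    (hn : n % 2 = 0) (hn1 : 1 ≤ n)
    {q r : Equiv.Perm (Fin (m - 1)) × (Fin (m - 1) → Bool)}
    (hqr : ∀ p ∈ Set.Icc 1 m ×ˢ Set.Icc 1 n, normLabel m n d c q p = normLabel m n d c r p) :
    q = r := by
  have key : ∀ i, 1 ≤ i → i ≤ m →
      rowSign q.2 i = rowSign r.2 i ∧ rowBlock q.1 i = rowBlock r.1 i := by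
    intro i hi him
    have heq := hqr (i, 1) ⟨⟨hi, him⟩, ⟨le_rfl, hn1⟩⟩
    have hbp := rowBlock_lt q.1 (i := i) hm
    have hbp' := rowBlock_lt r.1 (i := i) hm
    have ht := rowPos_lt (rowSign q.2 i) i le_rfl hn1 hn
    have ht' := rowPos_lt (rowSign r.2 i) i le_rfl hn1 hn
    have hle := h.le _ _ hbp ht
    have hle' := h.le _ _ hbp' ht'
    have hd := h.disj _ _ _ _ hbp ht hbp' ht'
    unfold normLabel progLabel at heq
    dsimp only at heq
    generalize decide (1 % 2 = 0) = z at heq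
    split_ifs at heq with h1 h2 h2
    · exact ⟨h1.trans h2.symm, (h.inj _ _ _ _ hbp ht hbp' ht' (by omega)).1⟩
    · omega
    · omega
    · exact ⟨(Bool.eq_not.2 h1).trans (Bool.eq_not.2 h2).symm,
        (h.inj _ _ _ _ hbp ht hbp' ht' heq).1⟩
  refine Prod.ext (Equiv.ext fun a => ?_) (funext fun a => ?_)
  · have := (key (a + 2) (by omega) (by omega)).2
    have hc : 2 ≤ (a : ℕ) + 2 ∧ (a : ℕ) + 2 ≤ m := by omega
    simp only [rowBlock, dif_pos hc] at this
    exact Fin.ext (Nat.succ_injective this)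
  · have := (key (a + 2) (by omega) (by omega)).1
    have hc : 2 ≤ (a : ℕ) + 2 ∧ (a : ℕ) + 2 ≤ m := by omega
    simp only [rowSign, dif_pos hc] at this
    exact this

theorem normLabel_add_succ {m n d : ℕ} {c : ℕ → ℕ} (h : IsProgPartition m n d c) (hm : 1 ≤ m)
    (hn : n % 2 = 0) (q : Equiv.Perm (Fin (m - 1)) × (Fin (m - 1) → Bool)) {k : ℕ} (hk : 1 ≤ k)
    (hk' : k ≤ n / 2 - 1) :
    (normLabel m n d c q (1, k) : ℤ) + normLabel m n d c q (1, k + 1) =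
      m * n + 1 + (-1) ^ k * d := by
  have := progLabel_add_adjacent (rowSign q.2) h hn (rowBlock_lt q.1 (i := 1) hm) hk
    (show k ≤ n by omega) (show 1 ≤ k + 1 by omega) (show k + 1 ≤ n by omega) (by omega)
  have e1 : (foldCol n k : ℤ) - foldCol n (k + 1) = -1 := by
    unfold foldCol
    split_ifs <;> omega
  rw [e1] at this
  unfold normLabel
  rw [this, pow_add]
  ring

theorem exists_labelings_of_isProgPartition {m n d : ℕ} {c : ℕ → ℕ}
    (h : IsProgPartition m n d c) (hm : 2 ≤ m) (hmo : m % 2 = 1) (hn : n % 2 = 0) (hn3 : 3 ≤ n)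
    (a : ℕ → ℕ)
    (ha : ∀ k, 1 ≤ k → k ≤ n / 2 - 1 → (a k : ℤ) = m * n + 1 + (-1) ^ k * d) :
    ∃ T : Finset (ℕ × ℕ → ℕ),
      2 ^ (m - 1) * Nat.factorial (m - 1) ≤ T.card ∧
      (∀ x ∈ T, (∃ S, IsC4FaceMagic m n x S) ∧
        ∀ k, 1 ≤ k → k ≤ n / 2 - 1 → x (1, k) + x (1, k + 1) = a k) ∧
      (∀ x ∈ T, ∀ y ∈ T, x ≠ y → ¬ KBEquiv m n x y) := by
  classical
  have hinj : Function.Injective (normLabel m n d c) := fun q r hqr =>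
    normLabel_ext h (by omega) hn (by omega) fun p _ => by rw [hqr]
  refine ⟨Finset.univ.image (normLabel m n d c), ?_, ?_, ?_⟩
  · rw [Finset.card_image_of_injective _ hinj, Finset.card_univ, Fintype.card_prod,
      Fintype.card_perm, Fintype.card_fun, Fintype.card_bool, Fintype.card_fin, mul_comm]
  · intro x hx
    obtain ⟨q, -, rfl⟩ := Finset.mem_image.1 hx
    refine ⟨⟨_, isC4FaceMagic_progLabel _ h hmo hn
      (fun i _ _ => rowBlock_lt q.1 (by omega)) (rowBlock_inj q.1)⟩, fun k hk hk' => ?_⟩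
    zify
    rw [ha k hk hk', normLabel_add_succ h (by omega) hn q hk hk']
  · intro x hx y hy hxy
    obtain ⟨q, -, rfl⟩ := Finset.mem_image.1 hx
    obtain ⟨r, -, rfl⟩ := Finset.mem_image.1 hy
    rintro ⟨A, hA, hAxy⟩
    refine hxy (congrArg _ (normLabel_ext h (by omega) hn (by omega) fun p hp => ?_))
    obtain ⟨k, s, hks⟩ := hA.exists_kbNormal hm hn
    have hbij := progLabel_bijOn (rowSign q.2) h hn
      (fun i _ _ => rowBlock_lt q.1 (by omega)) (rowBlock_inj q.1)
    have h11 : ((1, 1) : ℕ × ℕ) ∈ Set.Icc 1 m ×ˢ Set.Icc 1 n :=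
      ⟨⟨le_rfl, by omega⟩, ⟨le_rfl, by omega⟩⟩
    have hA11 := hks 1 1 le_rfl (by omega) le_rfl (by omega)
    have hfix : kbNormal m n k s (1, 1) = (1, 1) := by
      obtain ⟨q1, q2, q3, q4⟩ := kbNormal_mem (m := m) (k := k) (s := s) (i := 1)
        (by omega) hn le_rfl (show 1 ≤ n by omega)
      refine hbij.injOn ⟨⟨q1, q2⟩, ⟨q3, q4⟩⟩ h11 ?_
      have := hAxy (1, 1) h11
      rw [hA11] at this
      refine this.symm.trans ?_
      simp [normLabel, progLabel, rowSign, rowBlock]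
    obtain ⟨i, j⟩ := p
    rw [hAxy _ hp, hks i j hp.1.1 hp.1.2 hp.2.1 hp.2.2,
      kbNormal_eq_self hn hn3 hfix hp.1.1 hp.1.2]

/-- An enumeration `r` of `{0, …, m * (n / 2) - 1}` gives one of the lower half of `{1, …, m * n}`
(for `g = 1`) or of its odd elements (for `g = 2`). -/
theorem isProgPartition_of_enum {m n d g : ℕ} {c : ℕ → ℕ} (hn : n % 2 = 0) (hg : g = 1 ∨ g = 2)
    (r : ℕ → ℕ → ℕ) (hc : ∀ k t, c k + d * t = 1 + g * r k t)
    (hr : ∀ k t, k < m → t < n / 2 → r k t < m * (n / 2))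
    (hinj : ∀ k t k' t', k < m → t < n / 2 → k' < m → t' < n / 2 → r k t = r k' t' →
      k = k' ∧ t = t') :
    IsProgPartition m n d c := by
  have hmn : m * n = 2 * (m * (n / 2)) := by
    conv_lhs => rw [show n = 2 * (n / 2) by omega]
    ring
  constructor
  · intro k t _ _
    rw [hc]; omega
  · intro k t hk ht
    have := hr k t hk ht
    rw [hc]
    rcases hg with rfl | rfl <;> omega
  · intro k t k' t' hk ht hk' ht' heq
    refine hinj k t k' t' hk ht hk' ht' ?_
    rw [hc, hc] at heq
    rcases hg with rfl | rfl <;> omega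
  · intro k t k' t' hk ht hk' ht'
    have := hr k t hk ht
    have := hr k' t' hk' ht'
    rw [hc, hc]
    rcases hg with rfl | rfl <;> omega

theorem mul_add_lt_mul {p q k t : ℕ} (hk : k < p) (ht : t < q) : q * k + t < p * q := by
  have : q * (k + 1) ≤ q * p := Nat.mul_le_mul_left _ hk
  rw [mul_comm p q]
  linarith

theorem eq_and_eq_of_mul_add_eq {q k t k' t' : ℕ} (ht : t < q) (ht' : t' < q)
    (h : q * k + t = q * k' + t') : k = k' ∧ t = t' := by
  have h1 := congrArg (· / q) h
  have h2 := congrArg (· % q) h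
  simp only [Nat.mul_add_div (Nat.zero_lt_of_lt ht), Nat.mul_add_mod, Nat.div_eq_of_lt ht,
    Nat.div_eq_of_lt ht', Nat.mod_eq_of_lt ht, Nat.mod_eq_of_lt ht', add_zero] at h1 h2
  exact ⟨h1, h2⟩

theorem isProgPartition_blocks {m n g : ℕ} (hn : n % 2 = 0) (hg : g = 1 ∨ g = 2) :
    IsProgPartition m n g (fun k => 1 + g * (n / 2 * k)) :=
  isProgPartition_of_enum hn hg (fun k t => n / 2 * k + t) (fun k t => by ring)
    (fun _ _ hk ht => mul_add_lt_mul hk ht)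
    (fun _ _ _ _ _ ht _ ht' h => eq_and_eq_of_mul_add_eq ht ht' h)

theorem isProgPartition_residues {m n g : ℕ} (hn : n % 2 = 0) (hg : g = 1 ∨ g = 2) :
    IsProgPartition m n (g * m) (fun k => 1 + g * k) :=
  isProgPartition_of_enum hn hg (fun k t => m * t + k) (fun k t => by ring)
    (fun _ _ hk ht => (mul_add_lt_mul ht hk).trans_eq (mul_comm _ _))
    (fun _ _ _ _ hk _ hk' _ h => (eq_and_eq_of_mul_add_eq hk hk' h).symm)

/-- Let `m ≥ 3` be odd, `n ≥ 6` even with `n₁ = n/2` even, `n₀ = n₁ - 1`,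
and let `(a_1, …, a_{n₀})` be one of the four palindromic sequences
`(mn, mn+2, mn, …)`, `(mn-1, mn+3, mn-1, …)`, `(m(n-1)+1, m(n+1)+1, …)` or
`(m(n-2)+1, m(n+2)+1, …)`. Then there are at least `2^(m-1) * (m-1)!` pairwise Klein
bottle nonequivalent C₄-face-magic Klein bottle labelings `x` on `𝒦_{m,n}` with
`x_{1,k} + x_{1,k+1} = a_k` for all `1 ≤ k ≤ n₀`. -/
theorem kleinBottle_palindromic_sequences (m n : ℕ) (a : ℕ → ℕ) (hm : 3 ≤ m) (hmo : Odd m)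
    (hn : 6 ≤ n) (hne : Even n) (hn₁ : Even (n / 2))
    (ha : ((∀ k, 1 ≤ k → k ≤ n / 2 / 2 → a (2 * k - 1) = m * n) ∧
           (∀ k, 1 ≤ k → k ≤ n / 2 / 2 - 1 → a (2 * k) = m * n + 2)) ∨
          ((∀ k, 1 ≤ k → k ≤ n / 2 / 2 → a (2 * k - 1) = m * n - 1) ∧
           (∀ k, 1 ≤ k → k ≤ n / 2 / 2 - 1 → a (2 * k) = m * n + 3)) ∨
          ((∀ k, 1 ≤ k → k ≤ n / 2 / 2 → a (2 * k - 1) = m * (n - 1) + 1) ∧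
           (∀ k, 1 ≤ k → k ≤ n / 2 / 2 - 1 → a (2 * k) = m * (n + 1) + 1)) ∨
          ((∀ k, 1 ≤ k → k ≤ n / 2 / 2 → a (2 * k - 1) = m * (n - 2) + 1) ∧
           (∀ k, 1 ≤ k → k ≤ n / 2 / 2 - 1 → a (2 * k) = m * (n + 2) + 1))) :
    ∃ T : Finset (ℕ × ℕ → ℕ),
      2 ^ (m - 1) * Nat.factorial (m - 1) ≤ T.card ∧
      (∀ x ∈ T, (∃ S, IsC4FaceMagic m n x S) ∧
        ∀ k, 1 ≤ k → k ≤ n / 2 - 1 → x (1, k) + x (1, k + 1) = a k) ∧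
      (∀ x ∈ T, ∀ y ∈ T, x ≠ y → ¬ KBEquiv m n x y) := by
  have hmo' : m % 2 = 1 := Nat.odd_iff.1 hmo
  have hne' : n % 2 = 0 := Nat.even_iff.1 hne
  have hn₁' : n / 2 % 2 = 0 := Nat.even_iff.1 hn₁
  have alternating : ∀ (d u w : ℕ), (u : ℤ) = m * n + 1 - d → (w : ℤ) = m * n + 1 + d →
      (∀ k, 1 ≤ k → k ≤ n / 2 / 2 → a (2 * k - 1) = u) →
      (∀ k, 1 ≤ k → k ≤ n / 2 / 2 - 1 → a (2 * k) = w) →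
      ∀ k, 1 ≤ k → k ≤ n / 2 - 1 → (a k : ℤ) = m * n + 1 + (-1) ^ k * d := by
    intro d u w hu hw ho he k hk hk'
    rcases Nat.even_or_odd' k with ⟨l, rfl | rfl⟩
    · rw [he l (by omega) (by omega), hw, pow_mul]
      simp
    · have := ho (l + 1) (by omega) (by omega)
      rw [show 2 * (l + 1) - 1 = 2 * l + 1 by omega] at this
      rw [this, hu, pow_succ, pow_mul]
      simp [sub_eq_add_neg]
  have hmn : 1 ≤ m * n := Nat.mul_pos (by omega) (by omega)
  rcases ha with ⟨ho, he⟩ | ⟨ho, he⟩ | ⟨ho, he⟩ | ⟨ho, he⟩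
  · refine exists_labelings_of_isProgPartition (isProgPartition_blocks hne' (Or.inl rfl))
      (by omega) hmo' hne' (by omega) a (alternating _ _ _ ?_ ?_ ho he)
    · push_cast; ring
    · push_cast; ring
  · refine exists_labelings_of_isProgPartition (isProgPartition_blocks hne' (Or.inr rfl))
      (by omega) hmo' hne' (by omega) a (alternating _ _ _ ?_ ?_ ho he)
    · push_cast [Nat.cast_sub hmn]; ring
    · push_cast; ring
  · refine exists_labelings_of_isProgPartition (isProgPartition_residues hne' (Or.inl rfl))
      (by omega) hmo' hne' (by omega) a (alternating _ _ _ ?_ ?_ ho he)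
    · push_cast [Nat.cast_sub (show 1 ≤ n by omega)]; ring
    · push_cast; ring
  · refine exists_labelings_of_isProgPartition (isProgPartition_residues hne' (Or.inr rfl))
      (by omega) hmo' hne' (by omega) a (alternating _ _ _ ?_ ?_ ho he)
    · push_cast [Nat.cast_sub (show 2 ≤ n by omega)]; ring
    · push_cast; ring
end

section
/- Let m ≥ 3 be an odd integer and n ≥ 6 an even integer. If n ≡ 2 (mod 4), then the number of Klein bottle equivalence classes of C₄-face-magic Klein bottle labelings on 𝒦_{m,n} is at least (6·2^m)·(m−1)!; if n ≡ 0 (mod 4), then the number of Klein bottle equivalence classes of C₄-face-magic Klein bottle labelings on 𝒦_{m,n} is at least (5·2^m)·(m−1)!. -/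
/-- The vertex set of `𝒦_{m,n}`. -/
abbrev gridSet (m n : ℕ) : Set (ℕ × ℕ) := Set.Icc 1 m ×ˢ Set.Icc 1 n

theorem wrap_mem_Icc {n : ℕ} (hn : 0 < n) (j : ℕ) : wrap n j ∈ Set.Icc 1 n := by
  unfold wrap
  have := Nat.mod_lt j hn
  rw [Set.mem_Icc]
  split_ifs <;> omega

theorem wrap_of_le {n j : ℕ} (h1 : 1 ≤ j) (h2 : j ≤ n) : wrap n j = j := by
  unfold wrap
  rcases h2.lt_or_eq with h | rfl
  · rw [Nat.mod_eq_of_lt h, if_neg (by omega)]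
  · simp

theorem wrap_of_gt {n j : ℕ} (h1 : n < j) (h2 : j ≤ 2 * n) : wrap n j = j - n := by
  have h : j % n = (j - n) % n := Nat.mod_eq_sub_mod h1.le
  unfold wrap
  rw [h]
  exact wrap_of_le (by omega) (by omega)

theorem Umap_mem {m n : ℕ} {p : ℕ × ℕ} (hp : p ∈ gridSet m n) : Umap m n p ∈ gridSet m n := by
  obtain ⟨⟨h1, h2⟩, h3, h4⟩ := hp
  unfold Umap
  split_ifs <;> refine ⟨⟨?_, ?_⟩, ?_, ?_⟩ <;> simp only <;> omega

theorem Hmap_mem {m n : ℕ} {p : ℕ × ℕ} (hp : p ∈ gridSet m n) : Hmap n p ∈ gridSet m n :=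
  ⟨hp.1, wrap_mem_Icc (by have := hp.2.1; have := hp.2.2; omega) _⟩

theorem Umap_Hmap {m q : ℕ} {p : ℕ × ℕ} (hp : p ∈ gridSet m (2 * q)) :
    Umap m (2 * q) (Hmap (2 * q) p) = Hmap (2 * q) (Umap m (2 * q) p) := by
  obtain ⟨⟨h1, h2⟩, h3, h4⟩ := hp
  have hq : 2 * q / 2 = q := by omega
  by_cases h : p.1 < m
  · simp [Umap, Hmap, h]
  · simp only [Umap, Hmap, h, if_false, hq]
    congr 1
    rcases le_or_gt p.2 q with hj | hj
    · rw [wrap_of_le (by omega) (by omega), wrap_of_gt (by omega) (by omega)]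
      omega
    · rw [wrap_of_gt (by omega) (by omega), wrap_of_le (by omega) (by omega)]
      omega

theorem Hmap_Hmap {m q : ℕ} {p : ℕ × ℕ} (hp : p ∈ gridSet m (2 * q)) :
    Hmap (2 * q) (Hmap (2 * q) p) = p := by
  obtain ⟨⟨h1, h2⟩, h3, h4⟩ := hp
  have hq : 2 * q / 2 = q := by omega
  ext
  · rfl
  · simp only [Hmap, hq]
    rcases le_or_gt p.2 q with hj | hj
    · rw [wrap_of_le (j := p.2 + q) (by omega) (by omega), wrap_of_gt (by omega) (by omega)]
      omega
    · rw [wrap_of_gt (j := p.2 + q) (by omega) (by omega), wrap_of_le (by omega) (by omega)]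
      omega

theorem Umap_iterate {m n : ℕ} {p : ℕ × ℕ} (hp : p ∈ gridSet m n) {k : ℕ} (hk : k ≤ m) :
    (Umap m n)^[k] p = if p.1 + k ≤ m then (p.1 + k, p.2) else (p.1 + k - m, n + 1 - p.2) := by
  obtain ⟨⟨h1, h2⟩, h3, h4⟩ := hp
  induction k with
  | zero => simp [h2]
  | succ k ih =>
    rw [Function.iterate_succ_apply', ih (by omega)]
    unfold Umap
    split_ifs <;> simp only [Prod.mk.injEq, and_true] at * <;> omega

theorem Umap_iterate_m {m n : ℕ} {p : ℕ × ℕ} (hp : p ∈ gridSet m n) :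
    (Umap m n)^[m] p = Fmap n p := by
  rw [Umap_iterate hp le_rfl, if_neg (by have := hp.1.1; omega)]
  simp [Fmap]

/-- The restriction of `U` to the vertex set. -/
def gridU (m n : ℕ) (p : gridSet m n) : gridSet m n := ⟨Umap m n p, Umap_mem p.2⟩

/-- The restriction of `H` to the vertex set. -/
def gridH (m n : ℕ) (p : gridSet m n) : gridSet m n := ⟨Hmap n p, Hmap_mem p.2⟩

theorem coe_gridU_iterate {m n : ℕ} (k : ℕ) (p : gridSet m n) :
    (((gridU m n)^[k] p : gridSet m n) : ℕ × ℕ) = (Umap m n)^[k] p := by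
  induction k with
  | zero => rfl
  | succ k ih => rw [Function.iterate_succ_apply', Function.iterate_succ_apply', ← ih]; rfl

theorem coe_gridH_iterate {m n : ℕ} (k : ℕ) (p : gridSet m n) :
    (((gridH m n)^[k] p : gridSet m n) : ℕ × ℕ) = (Hmap n)^[k] p := by
  induction k with
  | zero => rfl
  | succ k ih => rw [Function.iterate_succ_apply', Function.iterate_succ_apply', ← ih]; rfl

theorem gridU_commute_gridH (m q : ℕ) :
    Function.Commute (gridU m (2 * q)) (gridH m (2 * q)) :=
  fun p => Subtype.ext (Umap_Hmap p.2)

theorem gridU_iterate_two_mul (m n : ℕ) (p : gridSet m n) : (gridU m n)^[2 * m] p = p := by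
  apply Subtype.ext
  have h : ∀ p : gridSet m n, (((gridU m n)^[m] p : gridSet m n) : ℕ × ℕ) = Fmap n p :=
    fun p => by rw [coe_gridU_iterate, Umap_iterate_m p.2]
  rw [two_mul, Function.iterate_add_apply, h, h]
  have h1 := p.2.2.1
  have h2 := p.2.2.2
  ext
  · rfl
  · simp only [Fmap]
    omega

theorem gridH_iterate_two (m q : ℕ) (p : gridSet m (2 * q)) : (gridH m (2 * q))^[2] p = p :=
  Subtype.ext (Hmap_Hmap p.2)

theorem MemKBLS.exists_iterate {m q : ℕ} {f : ℕ × ℕ → ℕ × ℕ} (hf : MemKBLS m (2 * q) f) :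
    ∃ a b, ∀ p : gridSet m (2 * q),
      f p = ((gridU m (2 * q))^[a] ((gridH m (2 * q))^[b] p) : gridSet m (2 * q)) := by
  induction hf with
  | one => exact ⟨0, 0, fun p => rfl⟩
  | genU => exact ⟨1, 0, fun p => rfl⟩
  | genH => exact ⟨0, 1, fun p => rfl⟩
  | genF =>
    refine ⟨m, 0, fun p => ?_⟩
    rw [coe_gridU_iterate]
    exact (Umap_iterate_m p.2).symm
  | comp _ _ ihf ihg =>
    obtain ⟨a, b, hab⟩ := ihf
    obtain ⟨a', b', hab'⟩ := ihg
    refine ⟨a + a', b + b', fun p => ?_⟩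
    rw [Function.comp_apply, hab', hab, Function.iterate_add_apply, Function.iterate_add_apply,
      ((gridU_commute_gridH m q).iterate_iterate a' b).eq]

theorem memKBLS_iterate (m n a b : ℕ) : MemKBLS m n ((Umap m n)^[a] ∘ (Hmap n)^[b]) := by
  refine .comp ?_ ?_
  · induction a with
    | zero => exact .one
    | succ a ih => exact .comp ih .genU
  · induction b with
    | zero => exact .one
    | succ b ih => exact .comp ih .genH

theorem kbEquiv_iff {m q : ℕ} (hm : 0 < m) {x y : ℕ × ℕ → ℕ} :
    KBEquiv m (2 * q) x y ↔ ∃ a : Fin (2 * m), ∃ b : Fin 2, ∀ p : gridSet m (2 * q),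
      y p = x ((gridU m (2 * q))^[a] ((gridH m (2 * q))^[b] p) : gridSet m (2 * q)) := by
  constructor
  · rintro ⟨A, hA, h⟩
    obtain ⟨a, b, hab⟩ := hA.exists_iterate
    refine ⟨⟨a % (2 * m), Nat.mod_lt _ (by omega)⟩, ⟨b % 2, Nat.mod_lt _ (by omega)⟩, fun p => ?_⟩
    have hU := fun p => Function.IsPeriodicPt.iterate_mod_apply (gridU_iterate_two_mul m (2 * q) p) a
    have hH := fun p => Function.IsPeriodicPt.iterate_mod_apply (gridH_iterate_two m q p) b
    simp only [hU, hH]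
    rw [h p p.2, hab]
  · rintro ⟨a, b, h⟩
    refine ⟨_, memKBLS_iterate m (2 * q) a b, fun p hp => ?_⟩
    rw [h ⟨p, hp⟩, coe_gridU_iterate, coe_gridH_iterate]
    rfl

theorem KBEquiv.symm {m q : ℕ} (hm : 0 < m) {x y : ℕ × ℕ → ℕ} (h : KBEquiv m (2 * q) x y) :
    KBEquiv m (2 * q) y x := by
  obtain ⟨a, b, h⟩ := (kbEquiv_iff hm).1 h
  refine ⟨_, memKBLS_iterate m (2 * q) (2 * m - a) (2 - b), fun p hp => ?_⟩
  have key := h ((gridU m (2 * q))^[2 * m - a] ((gridH m (2 * q))^[2 - b] ⟨p, hp⟩))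
  rw [← ((gridU_commute_gridH m q).iterate_iterate _ _).eq, ← Function.iterate_add_apply,
    ← Function.iterate_add_apply, Nat.add_sub_of_le a.2.le, Nat.add_sub_of_le b.2.le,
    gridU_iterate_two_mul, gridH_iterate_two] at key
  rw [← key, coe_gridU_iterate, coe_gridH_iterate]
  rfl

/-- A greedy transversal: if each element is related to at most `N` members of a finite family,
some pairwise unrelated subfamily has at least a `1 / N` proportion of its members. -/
theorem exists_pairwise_not_rel {ι X : Type*} [Fintype ι] (f : ι → X) (R : X → X → Prop)
    (hrefl : ∀ x, R x x) (hsymm : ∀ x y, R x y → R y x) (N : ℕ)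
    (hN : ∀ a, {b | R (f a) (f b)}.ncard ≤ N) :
    ∃ T : Finset X, Fintype.card ι ≤ T.card * N ∧ (∀ x ∈ T, ∃ a, f a = x) ∧
      ∀ x ∈ T, ∀ y ∈ T, x ≠ y → ¬ R x y := by
  classical
  obtain ⟨S, hS, hmax⟩ := Finset.exists_max_image
    (Finset.univ.filter fun S : Finset ι => ∀ a ∈ S, ∀ b ∈ S, a ≠ b → ¬ R (f a) (f b))
    Finset.card ⟨∅, by simp⟩
  simp only [Finset.mem_filter, Finset.mem_univ, true_and] at hS hmax
  have hcover : ∀ b, ∃ a ∈ S, R (f a) (f b) := by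
    intro b
    by_contra! hb
    have hbS : b ∉ S := fun h => hb b h (hrefl _)
    have := hmax (insert b S) (by
      intro c hc d hd hcd
      rw [Finset.mem_insert] at hc hd
      rcases hc with rfl | hc <;> rcases hd with rfl | hd
      · exact absurd rfl hcd
      · exact fun h => hb d hd (hsymm _ _ h)
      · exact hb c hc
      · exact hS c hc d hd hcd)
    rw [Finset.card_insert_of_notMem hbS] at this
    omega
  have hinj : Set.InjOn f S := by
    intro a ha b hb hab
    by_contra hne
    exact hS a ha b hb hne (hab ▸ hrefl _)
  refine ⟨S.image f, ?_, ?_, ?_⟩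
  · rw [Finset.card_image_of_injOn hinj]
    have hsub : (Finset.univ : Finset ι) ⊆
        S.biUnion fun a => Finset.univ.filter fun b => R (f a) (f b) := by
      intro b _
      obtain ⟨a, ha, hab⟩ := hcover b
      simp only [Finset.mem_biUnion, Finset.mem_filter, Finset.mem_univ, true_and]
      exact ⟨a, ha, hab⟩
    refine (Finset.card_le_card hsub).trans (Finset.card_biUnion_le_card_mul _ _ _ fun a _ => ?_)
    have := hN a
    rw [Set.ncard_eq_toFinset_card'] at this
    convert this using 2
    ext b
    simp
  · intro x hx
    obtain ⟨a, -, rfl⟩ := Finset.mem_image.1 hx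
    exact ⟨a, rfl⟩
  · intro x hx y hy hxy
    obtain ⟨a, ha, rfl⟩ := Finset.mem_image.1 hx
    obtain ⟨b, hb, rfl⟩ := Finset.mem_image.1 hy
    exact hS a ha b hb (fun h => hxy (congrArg f h))

/-- The translation attached to `u` when `{0, …, 2mq - 1}` is tiled by translates of the
arithmetic progression of length `q` and difference `k`. -/
def tileShift (q k u : ℕ) : ℕ := u % k + k * (q * (u / k))

theorem tileShift_eq_iff {q k u u' t t' : ℕ} (hk : 0 < k) (ht : t < q) (ht' : t' < q) :
    tileShift q k u + k * t = tileShift q k u' + k * t' ↔ u = u' ∧ t = t' := by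
  refine ⟨fun h => ?_, by rintro ⟨rfl, rfl⟩; rfl⟩
  have e : ∀ v s, tileShift q k v + k * s = v % k + k * (s + q * (v / k)) := fun v s => by
    unfold tileShift; ring
  rw [e, e] at h
  have h1 := congrArg (· % k) h
  have h2 := congrArg (· / k) h
  simp only [Nat.add_mul_mod_self_left, Nat.mod_mod, Nat.add_mul_div_left _ _ hk,
    Nat.div_eq_of_lt (Nat.mod_lt _ hk), zero_add] at h1 h2
  have h3 := congrArg (· % q) h2
  have h4 := congrArg (· / q) h2
  simp only [Nat.add_mul_mod_self_left, Nat.mod_eq_of_lt ht, Nat.mod_eq_of_lt ht',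
    Nat.add_mul_div_left _ _ (show 0 < q by omega), Nat.div_eq_of_lt ht, Nat.div_eq_of_lt ht',
    zero_add] at h3 h4
  refine ⟨?_, h3⟩
  rw [← Nat.mod_add_div u k, ← Nat.mod_add_div u' k, h1, h4]

theorem tileShift_reflect {q k M u t : ℕ} (hkM : k ∣ M) (hu : u < M) (ht : t < q) :
    tileShift q k u + k * t + (tileShift q k (M - 1 - u) + k * (q - 1 - t)) + 1 = M * q := by
  obtain ⟨l, rfl⟩ := hkM
  have hk : 0 < k := Nat.pos_of_ne_zero (by rintro rfl; simp at hu)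
  have hr := Nat.mod_lt u hk
  have hs : u / k < l := Nat.div_lt_of_lt_mul hu
  have hu' := Nat.mod_add_div u k
  unfold tileShift
  generalize u % k = r at *
  generalize u / k = s at *
  obtain ⟨r', rfl⟩ := Nat.exists_eq_add_of_lt hr
  obtain ⟨s', rfl⟩ := Nat.exists_eq_add_of_lt hs
  obtain ⟨t', rfl⟩ := Nat.exists_eq_add_of_lt ht
  have hv : (r + r' + 1) * (s + s' + 1) - 1 - u = r' + (r + r' + 1) * s' := by
    rw [← hu']
    have : (r + r' + 1) * (s + s' + 1) =
      (r' + (r + r' + 1) * s') + (r + (r + r' + 1) * s) + 1 := by ring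
    omega
  have hr₂ : r' < r + r' + 1 := by omega
  have ht' : t + t' + 1 - 1 - t = t' := by omega
  rw [hv, ht', Nat.add_mul_mod_self_left, Nat.add_mul_div_left _ _ hk, Nat.mod_eq_of_lt hr₂,
    Nat.div_eq_of_lt hr₂]
  ring

/-- The labeling of `𝒦_{m,2q}` whose rows are the tiles `u i` with entries in the order `t`,
every other entry (in checkerboard fashion) being replaced by its complement. -/
def tileLabeling (m q k : ℕ) (u t : ℕ → ℕ) (p : ℕ × ℕ) : ℕ :=
  if (p.1 + p.2) % 2 = 0 then tileShift q k (u p.1) + k * t p.2 + 1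
  else 2 * m * q - (tileShift q k (u p.1) + k * t p.2)

theorem tileLabeling_face {m q k : ℕ} {u t : ℕ → ℕ} {i i' j j' : ℕ}
    (hlt : ∀ a ∈ ({i, i'} : Set ℕ), ∀ b ∈ ({j, j'} : Set ℕ),
      tileShift q k (u a) + k * t b < 2 * m * q)
    (hi : (i + i') % 2 = 1) (hj : (j + j') % 2 = 1) :
    tileLabeling m q k u t (i, j) + tileLabeling m q k u t (i', j) +
      tileLabeling m q k u t (i, j') + tileLabeling m q k u t (i', j') =
      2 * (m * (2 * q) + 1) := by
  have h1 := hlt i (by simp) j (by simp)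
  have h2 := hlt i (by simp) j' (by simp)
  have h3 := hlt i' (by simp) j (by simp)
  have h4 := hlt i' (by simp) j' (by simp)
  have e : m * (2 * q) = 2 * m * q := by ring
  rw [e]
  unfold tileLabeling
  simp only
  generalize 2 * m * q = N at *
  generalize k * t j = b at *
  generalize k * t j' = b' at *
  rcases Nat.mod_two_eq_zero_or_one (i + j) with h | h
  · rw [if_pos h, if_neg (by omega), if_neg (by omega), if_pos (by omega)]; omega
  · rw [if_neg (by omega), if_pos (by omega), if_pos (by omega), if_neg (by omega)]; omega

theorem tileLabeling_twisted_face {m q k : ℕ} {u t : ℕ → ℕ} {i i' j j' l l' : ℕ}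
    (hlt : ∀ a ∈ ({i, i'} : Set ℕ), ∀ b ∈ ({j, j'} : Set ℕ),
      tileShift q k (u a) + k * t b < 2 * m * q)
    (hi : (i + i') % 2 = 0) (hj : (j + j') % 2 = 1) (hl : (j + l) % 2 = 1) (hl' : (l + l') % 2 = 1)
    (ht : t l = t j) (ht' : t l' = t j') :
    tileLabeling m q k u t (i, j) + tileLabeling m q k u t (i, j') +
      tileLabeling m q k u t (i', l) + tileLabeling m q k u t (i', l') =
      2 * (m * (2 * q) + 1) := by
  have h1 := hlt i (by simp) j (by simp)
  have h2 := hlt i (by simp) j' (by simp)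
  have h3 := hlt i' (by simp) j (by simp)
  have h4 := hlt i' (by simp) j' (by simp)
  have e : m * (2 * q) = 2 * m * q := by ring
  rw [e]
  unfold tileLabeling
  simp only [ht, ht']
  generalize 2 * m * q = N at *
  generalize k * t j = b at *
  generalize k * t j' = b' at *
  rcases Nat.mod_two_eq_zero_or_one (i + j) with h | h
  · rw [if_pos h, if_neg (by omega), if_neg (by omega), if_pos (by omega)]; omega
  · rw [if_neg (by omega), if_pos (by omega), if_pos (by omega), if_neg (by omega)]; omega

theorem isC4FaceMagic_tileLabeling {m q k : ℕ} {u t : ℕ → ℕ} (hmo : Odd m) (hk : k ∣ 2 * m)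
    (hu : ∀ i ∈ Set.Icc 1 m, u i < 2 * m) (hu_inj : Set.InjOn u (Set.Icc 1 m))
    (hu_compl : ∀ i ∈ Set.Icc 1 m, ∀ i' ∈ Set.Icc 1 m, u i ≠ 2 * m - 1 - u i')
    (ht : ∀ j ∈ Set.Icc 1 (2 * q), t j < q)
    (ht_eq : ∀ j ∈ Set.Icc 1 (2 * q), ∀ j' ∈ Set.Icc 1 (2 * q),
      t j = t j' ↔ j = j' ∨ j + j' = 2 * q + 1) :
    IsC4FaceMagic m (2 * q) (tileLabeling m q k u t) (2 * (m * (2 * q) + 1)) := by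
  have hm : 0 < m := hmo.pos
  have hk0 : 0 < k := Nat.pos_of_dvd_of_pos hk (by omega)
  have hlt : ∀ i ∈ Set.Icc 1 m, ∀ j ∈ Set.Icc 1 (2 * q),
      tileShift q k (u i) + k * t j < 2 * m * q := fun i hi j hj => by
    have := tileShift_reflect hk (hu i hi) (ht j hj)
    omega
  have hN : m * (2 * q) = 2 * m * q := by ring
  refine ⟨?_, ?_, ?_⟩
  · have hmaps : Set.MapsTo (tileLabeling m q k u t) (gridSet m (2 * q))
        (Set.Icc 1 (m * (2 * q))) := by
      rintro ⟨i, j⟩ ⟨hi, hj⟩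
      have := hlt i hi j hj
      rw [Set.mem_Icc, hN]
      unfold tileLabeling
      simp only
      split_ifs <;> omega
    have hinj : Set.InjOn (tileLabeling m q k u t) (gridSet m (2 * q)) := by
      rintro ⟨i, j⟩ ⟨hi, hj⟩ ⟨i', j'⟩ ⟨hi', hj'⟩ h
      simp only at hi hj hi' hj'
      have h1 := hlt i hi j hj
      have h2 := hlt i' hi' j' hj'
      have hsame : tileShift q k (u i) + k * t j = tileShift q k (u i') + k * t j' →
          (i + j) % 2 = (i' + j') % 2 → (i, j) = (i', j') := by
        intro h hpar
        obtain ⟨h3, h4⟩ := (tileShift_eq_iff hk0 (ht j hj) (ht j' hj')).1 h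
        have h5 := hu_inj hi hi' h3
        rcases (ht_eq j hj j' hj').1 h4 with h6 | h6
        · rw [h5, h6]
        · omega
      have hdiff : tileShift q k (u i) + k * t j + (tileShift q k (u i') + k * t j') + 1 ≠
          2 * m * q := by
        intro h
        have h3 := tileShift_reflect hk (hu i' hi') (ht j' hj')
        have h4 := ht j' hj'
        exact hu_compl i hi i' hi' ((tileShift_eq_iff (t' := q - 1 - t j') hk0 (ht j hj)
          (by omega)).1 (by omega)).1
      unfold tileLabeling at h
      simp only at h
      split_ifs at h with h3 h4 h4
      · exact hsame (by omega) (by omega)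
      · exact absurd (by omega) hdiff
      · exact absurd (by omega) hdiff
      · exact hsame (by omega) (by omega)
    refine ⟨hmaps, hinj, ?_⟩
    have hcard : (Set.Icc 1 (m * (2 * q))).ncard ≤
        (tileLabeling m q k u t '' gridSet m (2 * q)).ncard := by
      rw [hinj.ncard_image, Set.ncard_prod]
      simp [Set.ncard_eq_toFinset_card']
    rw [Set.SurjOn, Set.eq_of_subset_of_ncard_le hmaps.image_subset hcard (Set.finite_Icc _ _)]
  · intro i j hi hi' hj hj'
    have hw := wrap_mem_Icc (show 0 < 2 * q by omega) (j + 1)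
    apply tileLabeling_face
    · rintro a (rfl | rfl) b (rfl | rfl) <;> apply hlt <;>
        first | exact hw | (constructor <;> omega)
    · omega
    · rcases hj'.lt_or_eq with h | h
      · rw [wrap_of_le (by omega) (by omega)]; omega
      · rw [wrap_of_gt (by omega) (by omega)]; omega
  · intro j hj hj'
    have hw := wrap_mem_Icc (show 0 < 2 * q by omega) (j + 1)
    have hw' := wrap_mem_Icc (show 0 < 2 * q by omega) (2 * q - j)
    have hww : wrap (2 * q) (j + 1) + wrap (2 * q) (2 * q - j) = 2 * q + 1 ∧
        (j + wrap (2 * q) (j + 1)) % 2 = 1 := by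
      rcases hj'.lt_or_eq with h | h
      · rw [wrap_of_le (by omega) (by omega), wrap_of_le (by omega) (by omega)]; omega
      · rw [wrap_of_gt (by omega) (by omega), h, Nat.sub_self]
        simp [wrap]
        omega
    obtain ⟨c, rfl⟩ := hmo
    apply tileLabeling_twisted_face
    · rintro a (rfl | rfl) b (rfl | rfl) <;> apply hlt <;>
        first | exact hw | (constructor <;> omega)
    · omega
    · exact hww.2
    · omega
    · omega
    · exact (ht_eq _ ⟨by omega, by omega⟩ _ ⟨hj, hj'⟩).2 (by omega)
    · exact (ht_eq _ hw' _ hw).2 (by omega)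

/-- The tile used in row `i`: `σ` orders the complementary pairs of tiles, and `ε` chooses
a tile in each pair. -/
def rowTile (m : ℕ) (ε : Fin m → Bool) (σ : Equiv.Perm (Fin m)) (i : ℕ) : ℕ :=
  if h : i - 1 < m then
    if ε ⟨i - 1, h⟩ then 2 * m - 1 - σ ⟨i - 1, h⟩ else σ ⟨i - 1, h⟩
  else 0

/-- The position within its tile of the entry in column `j`, the columns `j` and `2q + 1 - j`
being ordered by `τ` in the same way. -/
def colPos (q : ℕ) (τ : Equiv.Perm (Fin q)) (j : ℕ) : ℕ :=
  if h : min (j - 1) (2 * q - j) < q then τ ⟨min (j - 1) (2 * q - j), h⟩ else 0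

theorem rowTile_succ {m : ℕ} (ε : Fin m → Bool) (σ : Equiv.Perm (Fin m)) (i : Fin m) :
    rowTile m ε σ (i + 1) = if ε i then 2 * m - 1 - σ i else σ i := by
  simp [rowTile]

theorem exists_fin_of_mem_Icc {m i : ℕ} (hi : i ∈ Set.Icc 1 m) : ∃ a : Fin m, i = a + 1 :=
  ⟨⟨i - 1, by have := hi.1; have := hi.2; omega⟩, by have := hi.1; simp; omega⟩

theorem rowTile_lt {m : ℕ} (ε : Fin m → Bool) (σ : Equiv.Perm (Fin m)) {i : ℕ}
    (hi : i ∈ Set.Icc 1 m) : rowTile m ε σ i < 2 * m := by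
  obtain ⟨a, rfl⟩ := exists_fin_of_mem_Icc hi
  rw [rowTile_succ]
  split_ifs <;> omega

theorem rowTile_injOn {m : ℕ} (ε : Fin m → Bool) (σ : Equiv.Perm (Fin m)) :
    Set.InjOn (rowTile m ε σ) (Set.Icc 1 m) := by
  intro i hi i' hi' h
  obtain ⟨a, rfl⟩ := exists_fin_of_mem_Icc hi
  obtain ⟨b, rfl⟩ := exists_fin_of_mem_Icc hi'
  rw [rowTile_succ, rowTile_succ] at h
  have : σ a = σ b := by
    ext
    split_ifs at h <;> omega
  rw [σ.injective this]

theorem rowTile_ne_compl {m : ℕ} (ε : Fin m → Bool) (σ : Equiv.Perm (Fin m)) {i i' : ℕ}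
    (hi : i ∈ Set.Icc 1 m) (hi' : i' ∈ Set.Icc 1 m) :
    rowTile m ε σ i ≠ 2 * m - 1 - rowTile m ε σ i' := by
  obtain ⟨a, rfl⟩ := exists_fin_of_mem_Icc hi
  obtain ⟨b, rfl⟩ := exists_fin_of_mem_Icc hi'
  rw [rowTile_succ, rowTile_succ]
  intro h
  have hab : σ a = σ b := by
    ext
    split_ifs at h <;> omega
  rw [σ.injective hab] at h
  split_ifs at h <;> omega

theorem rowTile_ext {m : ℕ} {ε ε' : Fin m → Bool} {σ σ' : Equiv.Perm (Fin m)}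
    (h : ∀ i ∈ Set.Icc 1 m, rowTile m ε σ i = rowTile m ε' σ' i) : ε = ε' ∧ σ = σ' := by
  have key : ∀ a : Fin m, ε a = ε' a ∧ σ a = σ' a := by
    intro a
    have ha := h (a + 1) ⟨by omega, by omega⟩
    rw [rowTile_succ, rowTile_succ] at ha
    cases h1 : ε a <;> cases h2 : ε' a <;> simp [h1, h2] at ha ⊢ <;> omega
  exact ⟨funext fun a => (key a).1, Equiv.ext fun a => (key a).2⟩

theorem colPos_succ {q : ℕ} (τ : Equiv.Perm (Fin q)) (c : Fin q) : colPos q τ (c + 1) = τ c := by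
  have : min ((c : ℕ) + 1 - 1) (2 * q - (c + 1)) = c := by omega
  simp only [colPos, this, c.2, dif_pos]

theorem exists_fin_colPos {q j : ℕ} (hj : j ∈ Set.Icc 1 (2 * q)) :
    ∃ c : Fin q, (j = c + 1 ∨ j + c = 2 * q) ∧ ∀ τ, colPos q τ j = τ c := by
  obtain ⟨h1, h2⟩ := hj
  have h : min (j - 1) (2 * q - j) < q := by omega
  refine ⟨⟨_, h⟩, ?_, fun τ => by simp only [colPos, h, dif_pos]⟩
  simp only
  omega

theorem colPos_eq_iff {q : ℕ} (τ : Equiv.Perm (Fin q)) {j j' : ℕ} (hj : j ∈ Set.Icc 1 (2 * q))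
    (hj' : j' ∈ Set.Icc 1 (2 * q)) :
    colPos q τ j = colPos q τ j' ↔ j = j' ∨ j + j' = 2 * q + 1 := by
  obtain ⟨c, hc, h⟩ := exists_fin_colPos hj
  obtain ⟨d, hd, h'⟩ := exists_fin_colPos hj'
  rw [h, h', ← Fin.ext_iff, τ.injective.eq_iff, Fin.ext_iff]
  omega

/-- Four divisors of `2m`. -/
def tileStep (m : ℕ) : Fin 4 → ℕ := ![1, 2, m, 2 * m]

theorem tileStep_dvd (m : ℕ) (e : Fin 4) : tileStep m e ∣ 2 * m := by
  fin_cases e <;> simp [tileStep]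

theorem tileStep_injective {m : ℕ} (hm : 3 ≤ m) : Function.Injective (tileStep m) := by
  intro e e' h
  fin_cases e <;> fin_cases e' <;> simp [tileStep] at h ⊢ <;> omega

/-- The data parametrizing the labelings that are counted. -/
abbrev TileData (m q : ℕ) : Type :=
  Fin 4 × (Fin m → Bool) × Equiv.Perm (Fin m) × Equiv.Perm (Fin q)

/-- The labeling of `𝒦_{m,2q}` with given data. -/
def dataLabeling (m q : ℕ) (d : TileData m q) : ℕ × ℕ → ℕ :=
  tileLabeling m q (tileStep m d.1) (rowTile m d.2.1 d.2.2.1) (colPos q d.2.2.2)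

theorem isC4FaceMagic_dataLabeling {m q : ℕ} (hmo : Odd m) (d : TileData m q) :
    IsC4FaceMagic m (2 * q) (dataLabeling m q d) (2 * (m * (2 * q) + 1)) := by
  refine isC4FaceMagic_tileLabeling hmo (tileStep_dvd m _) (fun i hi => rowTile_lt _ _ hi)
    (rowTile_injOn _ _) (fun i hi i' hi' => rowTile_ne_compl _ _ hi hi') (fun j hj => ?_)
    (fun j hj j' hj' => colPos_eq_iff _ hj hj')
  obtain ⟨c, -, h⟩ := exists_fin_colPos hj
  rw [h]
  exact Fin.is_lt _

theorem tileStep_le_of_add_eq {q k k' a a' : ℕ} (hq : 2 ≤ q) {τ τ' : Equiv.Perm (Fin q)}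
    (h : ∀ c, a + k * τ c = a' + k' * τ' c) : k ≤ k' := by
  have h0 := h (τ.symm ⟨0, by omega⟩)
  have h1 := h (τ.symm ⟨q - 1, by omega⟩)
  simp only [Equiv.apply_symm_apply, mul_zero, add_zero] at h0 h1
  have h2 : k' * (τ' (τ.symm ⟨q - 1, by omega⟩) : ℕ) ≤ k' * (q - 1) :=
    Nat.mul_le_mul_left _ (by omega)
  have h3 : k * (q - 1) ≤ k' * (q - 1) := by omega
  exact Nat.le_of_mul_le_mul_right h3 (by omega)

theorem dataLabeling_ext {m q : ℕ} (hm : 3 ≤ m) (hq : 2 ≤ q) {d d' : TileData m q}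
    (h : ∀ p ∈ gridSet m (2 * q), dataLabeling m q d p = dataLabeling m q d' p) : d = d' := by
  obtain ⟨e, ε, σ, τ⟩ := d
  obtain ⟨e', ε', σ', τ'⟩ := d'
  have hpos : ∀ e, 0 < tileStep m e :=
    fun e => Nat.pos_of_dvd_of_pos (tileStep_dvd m e) (by omega)
  have hlt : ∀ e ε σ (τ : Equiv.Perm (Fin q)) i (c : Fin q), i ∈ Set.Icc 1 m →
      tileShift q (tileStep m e) (rowTile m ε σ i) + tileStep m e * τ c < 2 * m * q := by
    intro e ε σ τ i c hi
    have := tileShift_reflect (tileStep_dvd m e) (rowTile_lt ε σ hi) (τ c).2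
    omega
  have key : ∀ i ∈ Set.Icc 1 m, ∀ c : Fin q,
      tileShift q (tileStep m e) (rowTile m ε σ i) + tileStep m e * τ c =
      tileShift q (tileStep m e') (rowTile m ε' σ' i) + tileStep m e' * τ' c := by
    intro i hi c
    have h1 := h (i, c + 1) ⟨hi, by simp, by simp; omega⟩
    have h2 := hlt e ε σ τ i c hi
    have h3 := hlt e' ε' σ' τ' i c hi
    simp only [dataLabeling, tileLabeling, colPos_succ] at h1
    split_ifs at h1 <;> omega
  have h1m : 1 ∈ Set.Icc 1 m := ⟨le_rfl, by omega⟩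
  have hk : tileStep m e = tileStep m e' := le_antisymm (tileStep_le_of_add_eq hq (key 1 h1m))
    (tileStep_le_of_add_eq hq fun c => (key 1 h1m c).symm)
  obtain rfl := tileStep_injective hm hk
  have key' := fun i hi c => (tileShift_eq_iff (hpos e) (τ c).2 (τ' c).2).1 (key i hi c)
  have hτ : τ = τ' := Equiv.ext fun c => Fin.ext (key' 1 h1m c).2
  obtain ⟨rfl, rfl⟩ := rowTile_ext fun i hi => (key' i hi ⟨0, by omega⟩).1
  rw [hτ]

theorem ncard_kbEquiv_dataLabeling_le {m q : ℕ} (hm : 3 ≤ m) (hq : 2 ≤ q) (d : TileData m q) :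
    {d' | KBEquiv m (2 * q) (dataLabeling m q d) (dataLabeling m q d')}.ncard ≤ 4 * m := by
  have hm0 : 0 < m := by omega
  have h : ∀ d' ∈ {d' | KBEquiv m (2 * q) (dataLabeling m q d) (dataLabeling m q d')},
      ∃ s : Fin (2 * m) × Fin 2, ∀ p : gridSet m (2 * q), dataLabeling m q d' p =
        dataLabeling m q d
          ((gridU m (2 * q))^[s.1] ((gridH m (2 * q))^[s.2] p) : gridSet m (2 * q)) := by
    intro d' hd'
    obtain ⟨a, b, hab⟩ := (kbEquiv_iff hm0).1 hd'
    exact ⟨(a, b), hab⟩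
  have : NeZero (2 * m) := ⟨by omega⟩
  choose! g hg using h
  have := Set.ncard_le_ncard_of_injOn (t := Set.univ) g (fun _ _ => Set.mem_univ _)
    (fun d₁ h₁ d₂ h₂ h₁₂ => dataLabeling_ext hm hq fun p hp => by
      rw [hg d₁ h₁ ⟨p, hp⟩, hg d₂ h₂ ⟨p, hp⟩, h₁₂])
  refine this.trans (le_of_eq ?_)
  rw [Set.ncard_univ, Nat.card_eq_fintype_card]
  simp only [Fintype.card_prod, Fintype.card_fin]
  ring

theorem exists_six_mul_labelings {m q : ℕ} (hm : 3 ≤ m) (hmo : Odd m) (hq : 3 ≤ q) :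
    ∃ T : Finset (ℕ × ℕ → ℕ), 6 * 2 ^ m * Nat.factorial (m - 1) ≤ T.card ∧
      (∀ x ∈ T, ∃ S, IsC4FaceMagic m (2 * q) x S) ∧
      (∀ x ∈ T, ∀ y ∈ T, x ≠ y → ¬ KBEquiv m (2 * q) x y) := by
  obtain ⟨T, hcard, hmem, hT⟩ := exists_pairwise_not_rel (dataLabeling m q) (KBEquiv m (2 * q))
    (fun _ => ⟨id, .one, fun _ _ => rfl⟩) (fun _ _ h => h.symm (by omega)) (4 * m)
    (ncard_kbEquiv_dataLabeling_le hm (by omega))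
  refine ⟨T, ?_, fun x hx => ?_, hT⟩
  · simp only [Fintype.card_prod, Fintype.card_fin, Fintype.card_fun, Fintype.card_bool,
      Fintype.card_perm] at hcard
    have hq6 : 6 ≤ Nat.factorial q := Nat.factorial_le hq
    have hfac := Nat.mul_factorial_pred (show m ≠ 0 by omega)
    refine Nat.le_of_mul_le_mul_right (c := 4 * m) (le_trans ?_ hcard) (by omega)
    rw [← hfac]
    calc 6 * 2 ^ m * Nat.factorial (m - 1) * (4 * m)
        = 4 * (2 ^ m * (m * Nat.factorial (m - 1) * 6)) := by ring
      _ ≤ _ := by gcongr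
  · obtain ⟨d, rfl⟩ := hmem x hx
    exact ⟨_, isC4FaceMagic_dataLabeling hmo d⟩

/-- Let `m ≥ 3` be odd and `n ≥ 6` even. If `n ≡ 2 (mod 4)` then there
are at least `6·2^m·(m-1)!` Klein bottle equivalence classes of C₄-face-magic Klein bottle
labelings on `𝒦_{m,n}`, and if `n ≡ 0 (mod 4)` then there are at least `5·2^m·(m-1)!`
such classes; in each case this is witnessed by that many pairwise Klein bottle
nonequivalent labelings. -/
theorem kleinBottle_min_count_classes (m n : ℕ) (hm : 3 ≤ m) (hmo : Odd m)
    (hn : 6 ≤ n) (hne : Even n) :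
    (n % 4 = 2 → ∃ T : Finset (ℕ × ℕ → ℕ),
      6 * 2 ^ m * Nat.factorial (m - 1) ≤ T.card ∧
      (∀ x ∈ T, ∃ S, IsC4FaceMagic m n x S) ∧
      (∀ x ∈ T, ∀ y ∈ T, x ≠ y → ¬ KBEquiv m n x y)) ∧
    (n % 4 = 0 → ∃ T : Finset (ℕ × ℕ → ℕ),
      5 * 2 ^ m * Nat.factorial (m - 1) ≤ T.card ∧
      (∀ x ∈ T, ∃ S, IsC4FaceMagic m n x S) ∧
      (∀ x ∈ T, ∀ y ∈ T, x ≠ y → ¬ KBEquiv m n x y)) := by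
  obtain ⟨q, rfl⟩ := hne.two_dvd
  obtain ⟨T, hcard, hT⟩ := exists_six_mul_labelings (q := q) hm hmo (by omega)
  refine ⟨fun _ => ⟨T, hcard, hT⟩, fun _ => ⟨T, le_trans ?_ hcard, hT⟩⟩
  gcongr
  norm_num
end
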